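/- For every integer N ≥ 2 one has (1/2)·arccos(−1/(N−1)) ≥ π/4. Consequently, if 0 < a ≤ π/4, then for every integer N ≥ 2 the principal argument is injective on C_in: for any z₁, z₂ ∈ C_in with arg z₁ = arg z₂ one has z₁ = z₂. -/

import Mathlib

open Real

/-- The inner boundary curve of the support. -/
def Cin (a : ℝ) (N : ℕ) : Set ℂ :=
  {z | ∃ k : ℕ, k ≤ N - 1 ∧ ∃ φ ∈ Set.Icc (-a) a,
    z = (k : ℂ) * Complex.exp ((a : ℂ) * Complex.I)
      + ((N - 1 - k : ℕ) : ℂ) * Complex.exp (-(a : ℂ) * Complex.I)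
      + Complex.exp ((φ : ℂ) * Complex.I)}

lemma slope_lt (a M c p q : ℝ) (ha : 0 < a) (ha' : a ≤ π / 4) (hM : 0 < M)
    (hc : |c| ≤ M * sin a) (hp : -a ≤ p) (hq : q ≤ a) (hpq : p < q) :
    (c + sin p) / (M * cos a + cos p) < (c + sin q) / (M * cos a + cos q) := by
  have hpi := Real.pi_pos
  have ca : 0 < cos a := cos_pos_of_mem_Ioo ⟨by linarith, by linarith⟩
  have cp : 0 < cos p := cos_pos_of_mem_Ioo ⟨by linarith, by linarith⟩
  have cq : 0 < cos q := cos_pos_of_mem_Ioo ⟨by linarith, by linarith⟩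
  rw [div_lt_div_iff₀ (by positivity) (by positivity)]
  obtain ⟨m, hm⟩ : ∃ m, m = (p + q) / 2 := ⟨_, rfl⟩
  obtain ⟨d, hd⟩ : ∃ d, d = (q - p) / 2 := ⟨_, rfl⟩
  have e1 : p = m - d := by rw [hm, hd]; ring
  have e2 : q = m + d := by rw [hm, hd]; ring
  have sd : 0 < sin d := sin_pos_of_pos_of_lt_pi (by linarith) (by linarith)
  have cd : 0 < cos d := cos_pos_of_mem_Ioo ⟨by linarith, by linarith⟩
  have h1 : 0 ≤ cos (a + m) := cos_nonneg_of_mem_Icc ⟨by linarith, by linarith⟩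
  have h2 : 0 ≤ cos (a - m) := cos_nonneg_of_mem_Icc ⟨by linarith, by linarith⟩
  rw [cos_add] at h1
  rw [cos_sub] at h2
  have hcm : -(M * (cos a * cos m)) ≤ c * sin m := by
    have h3 : |c * sin m| ≤ M * sin a * |sin m| := by
      rw [abs_mul]; exact mul_le_mul_of_nonneg_right hc (abs_nonneg _)
    have h4 : sin a * |sin m| ≤ cos a * cos m := by
      rcases abs_cases (sin m) with ⟨h, _⟩ | ⟨h, _⟩ <;> rw [h] <;> linarith
    have h5 := mul_le_mul_of_nonneg_left h4 hM.le
    have := neg_abs_le (c * sin m)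
    linarith
  have key : (c + sin q) * (M * cos a + cos p) - (c + sin p) * (M * cos a + cos q)
      = 2 * sin d * (c * sin m + M * (cos a * cos m) + cos d) := by
    rw [e1, e2, sin_add, sin_sub, cos_add, cos_sub]
    linear_combination (2 * sin d * cos d) * (sin_sq_add_cos_sq m)
  have : 0 < 2 * sin d * (c * sin m + M * (cos a * cos m) + cos d) := by
    apply mul_pos <;> linarith
  linarith

lemma slope_le (a M c p q : ℝ) (ha : 0 < a) (ha' : a ≤ π / 4) (hM : 0 < M)
    (hc : |c| ≤ M * sin a) (hp : -a ≤ p) (hq : q ≤ a) (hpq : p ≤ q) :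
    (c + sin p) / (M * cos a + cos p) ≤ (c + sin q) / (M * cos a + cos q) := by
  rcases hpq.eq_or_lt with h | h
  · rw [h]
  · exact (slope_lt a M c p q ha ha' hM hc hp hq h).le

lemma core (a M : ℝ) (k l : ℕ) (p q : ℝ) (ha : 0 < a) (ha' : a ≤ π / 4) (hM : 0 < M)
    (hk : (k : ℝ) ≤ M) (hl : (l : ℝ) ≤ M)
    (hp : p ∈ Set.Icc (-a) a) (hq : q ∈ Set.Icc (-a) a) (hkl : k ≤ l)
    (h : ((2 * k - M) * sin a + sin p) / (M * cos a + cos p)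
      = ((2 * l - M) * sin a + sin q) / (M * cos a + cos q)) :
    M * cos a + cos p = M * cos a + cos q ∧
    (2 * k - M) * sin a + sin p = (2 * l - M) * sin a + sin q := by
  have hpi := Real.pi_pos
  have sa : 0 < sin a := sin_pos_of_pos_of_lt_pi ha (by linarith)
  have ca : 0 < cos a := cos_pos_of_mem_Ioo ⟨by linarith, by linarith⟩
  have hc : ∀ j : ℕ, (j : ℝ) ≤ M → |(2 * j - M) * sin a| ≤ M * sin a := by
    intro j hj
    have : (0 : ℝ) ≤ j := Nat.cast_nonneg j
    rw [abs_mul, abs_of_pos sa]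
    apply mul_le_mul_of_nonneg_right _ sa.le
    rw [abs_le]; constructor <;> linarith
  obtain ⟨hp1, hp2⟩ := hp
  obtain ⟨hq1, hq2⟩ := hq
  rcases hkl.eq_or_lt with rfl | hlt
  · have : p = q := by
      rcases lt_trichotomy p q with h' | h' | h'
      · exact absurd h (slope_lt a M _ p q ha ha' hM (hc k hk) hp1 hq2 h').ne
      · exact h'
      · exact absurd h (slope_lt a M _ q p ha ha' hM (hc k hk) hq1 hp2 h').ne'
    subst this; simp
  · have hlt' : (k : ℝ) + 1 ≤ l := by exact_mod_cast hlt
    have mid : ((2 * k - M) * sin a + sin a) / (M * cos a + cos a)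
        ≤ ((2 * l - M) * sin a + sin (-a)) / (M * cos a + cos (-a)) := by
      rw [cos_neg, sin_neg]
      apply div_le_div_of_nonneg_right _ (by positivity)
      nlinarith
    have A := slope_le a M _ p a ha ha' hM (hc k hk) hp1 le_rfl hp2
    have B := slope_le a M _ (-a) q ha ha' hM (hc l hl) le_rfl hq2 hq1
    have hpa : p = a := by
      by_contra hne
      have := slope_lt a M _ p a ha ha' hM (hc k hk) hp1 le_rfl (lt_of_le_of_ne hp2 hne)
      linarith
    have hqa : q = -a := by
      by_contra hne
      have := slope_lt a M _ (-a) q ha ha' hM (hc l hl) le_rfl hq2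
        (lt_of_le_of_ne hq1 (Ne.symm hne))
      linarith
    subst hpa; subst hqa
    rw [cos_neg] at *
    refine ⟨rfl, ?_⟩
    have hX : M * cos p + cos p ≠ 0 := by positivity
    exact (div_left_inj' hX).1 h

lemma Cin_coords (a : ℝ) (N : ℕ) (hN : 2 ≤ N) (z : ℂ) (hz : z ∈ Cin a N) :
    ∃ k : ℕ, (k : ℝ) ≤ (N : ℝ) - 1 ∧ ∃ p ∈ Set.Icc (-a) a,
      z.re = ((N : ℝ) - 1) * cos a + cos p ∧
      z.im = (2 * k - ((N : ℝ) - 1)) * sin a + sin p := by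
  obtain ⟨k, hk, p, hp, rfl⟩ := hz
  have h1 : ((N - 1 - k : ℕ) : ℝ) = (N : ℝ) - 1 - k := by
    rw [Nat.cast_sub hk, Nat.cast_sub (by omega)]; simp
  have h2 : ((N - 1 - k : ℕ) : ℂ) = (((N - 1 - k : ℕ) : ℝ) : ℂ) := by simp
  have h3 : (k : ℂ) = ((k : ℝ) : ℂ) := by simp
  have h4 : -(a : ℂ) = ((-a : ℝ) : ℂ) := by simp
  have h5 : (0 : ℝ) ≤ ((N - 1 - k : ℕ) : ℝ) := Nat.cast_nonneg _
  refine ⟨k, by linarith, p, hp, ?_, ?_⟩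
  · rw [h2, h3, h4, h1]
    simp only [Complex.add_re, Complex.re_ofReal_mul, Complex.exp_ofReal_mul_I_re, cos_neg]
    ring
  · rw [h2, h3, h4, h1]
    simp only [Complex.add_im, Complex.im_ofReal_mul, Complex.exp_ofReal_mul_I_im, sin_neg]
    ring

theorem stmt15 (a : ℝ) (ha : 0 < a) (ha' : a ≤ π / 4) :
    (∀ N : ℕ, 2 ≤ N → π / 4 ≤ (1 / 2) * Real.arccos (-1 / ((N : ℝ) - 1))) ∧
    (∀ N : ℕ, 2 ≤ N →
      ∀ z₁ ∈ Cin a N, ∀ z₂ ∈ Cin a N, Complex.arg z₁ = Complex.arg z₂ → z₁ = z₂) := by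
  constructor
  · intro N hN
    have hN' : (2 : ℝ) ≤ N := by exact_mod_cast hN
    have : π / 2 ≤ Real.arccos (-1 / ((N : ℝ) - 1)) := by
      rw [← Real.arccos_zero]
      apply Real.arccos_le_arccos
      exact div_nonpos_of_nonpos_of_nonneg (by norm_num) (by linarith)
    linarith
  · intro N hN z₁ h₁ z₂ h₂ h
    have hN' : (2 : ℝ) ≤ N := by exact_mod_cast hN
    obtain ⟨k, hk, p, hp, r1, i1⟩ := Cin_coords a N hN z₁ h₁
    obtain ⟨l, hl, q, hq, r2, i2⟩ := Cin_coords a N hN z₂ h₂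
    have ht : z₁.im / z₁.re = z₂.im / z₂.re := by
      rw [← Complex.tan_arg, ← Complex.tan_arg, h]
    rw [r1, r2, i1, i2] at ht
    rcases le_total k l with hkl | hkl
    · obtain ⟨e, f⟩ := core a (N - 1) k l p q ha ha' (by linarith) hk hl hp hq hkl ht
      exact Complex.ext (by rw [r1, r2, e]) (by rw [i1, i2, f])
    · obtain ⟨e, f⟩ := core a (N - 1) l k q p ha ha' (by linarith) hl hk hq hp hkl ht.symm
      exact Complex.ext (by rw [r1, r2, e]) (by rw [i1, i2, f])
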